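/- arXiv:math/0312033 — 2 statements merged into one kernel-verified Lean document; each statement's English description precedes it below -/
import Mathlib

section
/- Let l, l1, l2 be lightlike vectors in the closed forward light cone V̄+ such that {l, l1} and {l, l2} are each linearly independent. Then the intersection W[l,l1] ∩ W[l,l2] of the two wedges is a nonempty open subset of M4. -/
noncomputable section

/-- Minkowski spacetime: ℝ⁴. -/
abbrev M4 : Type := Fin 4 → ℝ

/-- Minkowski bilinear form. -/
def mink (x y : M4) : ℝ := x 0 * y 0 - x 1 * y 1 - x 2 * y 2 - x 3 * y 3

/-- Lightlike vector. -/
def Lightlike (l : M4) : Prop := l ≠ 0 ∧ mink l l = 0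

/-- Closed forward light cone. -/
def closedForwardCone : Set M4 := {x | 0 ≤ mink x x ∧ 0 ≤ x 0}

/-- Open forward light cone. -/
def openForwardCone : Set M4 := {x | 0 < mink x x ∧ 0 < x 0}

/-- The wedge W[l₁,l₂]. -/
def wedge (l1 l2 : M4) : Set M4 :=
  {x | ∃ (α β : ℝ) (p : M4), 0 < α ∧ β < 0 ∧ mink p l1 = 0 ∧ mink p l2 = 0 ∧
      x = α • l1 + β • l2 + p}

/-- Spacelike complement of a set. -/
def scomp (S : Set M4) : Set M4 := {x | ∀ s ∈ S, mink (x - s) (x - s) < 0}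

/-- Causal complement: the interior of the spacelike complement. -/
def ccomp (S : Set M4) : Set M4 := interior (scomp S)

lemma mink_add_left (x y z : M4) : mink (x + y) z = mink x z + mink y z := by
  simp only [mink, Pi.add_apply]; ring

lemma mink_smul_left (a : ℝ) (x y : M4) : mink (a • x) y = a * mink x y := by
  simp only [mink, Pi.smul_apply, smul_eq_mul]; ring

lemma mink_comm (x y : M4) : mink x y = mink y x := by
  simp only [mink]; ring

lemma continuous_mink_left (y : M4) : Continuous fun x : M4 => mink x y := by
  unfold mink; fun_prop

lemma eq_zero_of_sum_three_sq_nonpos {x y z : ℝ} (h : x ^ 2 + y ^ 2 + z ^ 2 ≤ 0) :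
    x = 0 ∧ y = 0 ∧ z = 0 := by
  have hx := sq_nonneg x
  have hy := sq_nonneg y
  have hz := sq_nonneg z
  refine ⟨?_, ?_, ?_⟩ <;> rw [← sq_eq_zero_iff] <;> linarith

/-- Linearly independent lightlike vectors in the forward cone have positive product. -/
lemma mink_pos_of_lightlike {a b : M4} (ha : Lightlike a) (hb : Lightlike b)
    (hca : a ∈ closedForwardCone) (hcb : b ∈ closedForwardCone)
    (hli : LinearIndependent ℝ ![a, b]) : 0 < mink a b := by
  by_contra! hle
  obtain ⟨hane, ha⟩ := ha
  obtain ⟨-, hb⟩ := hb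
  have ha0 : 0 ≤ a 0 := hca.2
  have hb0 : 0 ≤ b 0 := hcb.2
  simp only [mink] at ha hb hle
  have hsum : (b 0 * a 1 - a 0 * b 1) ^ 2 + (b 0 * a 2 - a 0 * b 2) ^ 2
      + (b 0 * a 3 - a 0 * b 3) ^ 2 ≤ 0 := by
    have hmul := mul_nonneg (mul_nonneg ha0 hb0) (sub_nonneg.2 hle)
    linear_combination 2 * hmul - b 0 ^ 2 * ha - a 0 ^ 2 * hb
  obtain ⟨e1, e2, e3⟩ := eq_zero_of_sum_three_sq_nonpos hsum
  have hrel : b 0 • a + (-a 0) • b = 0 := by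
    ext i
    fin_cases i <;> simp only [Fin.zero_eta, Fin.mk_one, Fin.reduceFinMk, Pi.add_apply,
      Pi.smul_apply, smul_eq_mul, Pi.zero_apply]
    · ring
    · linear_combination e1
    · linear_combination e2
    · linear_combination e3
  have hz : a 0 = 0 := neg_eq_zero.1 (LinearIndependent.pair_iff.1 hli _ _ hrel).2
  rw [hz] at ha
  obtain ⟨h1, h2, h3⟩ := eq_zero_of_sum_three_sq_nonpos
    (show a 1 ^ 2 + a 2 ^ 2 + a 3 ^ 2 ≤ 0 by linarith only [ha])
  apply hane
  ext i
  fin_cases i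
  exacts [hz, h1, h2, h3]

/-- A wedge is cut out by the signs of the products with its lightlike generators. -/
lemma wedge_eq_setOf_mink {a b : M4} (ha : mink a a = 0) (hb : mink b b = 0)
    (hab : 0 < mink a b) : wedge a b = {x | 0 < mink x b ∧ mink x a < 0} := by
  ext x
  constructor
  · rintro ⟨α, β, p, hα, hβ, hpa, hpb, rfl⟩
    simp only [Set.mem_ofPred_eq, mink_add_left, mink_smul_left, ha, hb, hpa, hpb, mink_comm b a,
      mul_zero, add_zero, zero_add]
    exact ⟨mul_pos hα hab, mul_neg_of_neg_of_pos hβ hab⟩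
  · rintro ⟨hxb, hxa⟩
    refine ⟨mink x b / mink a b, mink x a / mink a b,
      x + (-(mink x b / mink a b)) • a + (-(mink x a / mink a b)) • b,
      div_pos hxb hab, div_neg_of_neg_of_pos hxa hab, ?_, ?_, by module⟩
    · simp only [mink_add_left, mink_smul_left, ha, mink_comm b a]
      field_simp; ring
    · simp only [mink_add_left, mink_smul_left, hb]
      field_simp; ring

theorem wedge_inter_nonempty_open (l l1 l2 : M4)
    (hl : Lightlike l) (h1 : Lightlike l1) (h2 : Lightlike l2)
    (hcl : l ∈ closedForwardCone) (hc1 : l1 ∈ closedForwardCone)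
    (hc2 : l2 ∈ closedForwardCone)
    (hli1 : LinearIndependent ℝ ![l, l1]) (hli2 : LinearIndependent ℝ ![l, l2]) :
    (wedge l l1 ∩ wedge l l2).Nonempty ∧ IsOpen (wedge l l1 ∩ wedge l l2) := by
  have hp1 := mink_pos_of_lightlike hl h1 hcl hc1 hli1
  have hp2 := mink_pos_of_lightlike hl h2 hcl hc2 hli2
  rw [wedge_eq_setOf_mink hl.2 h1.2 hp1, wedge_eq_setOf_mink hl.2 h2.2 hp2]
  constructor
  · have hq : 0 < |mink l1 l2| + 1 := by positivity
    have hle := le_abs_self (mink l1 l2)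
    have hr1 := mul_pos (div_pos hq hp2) hp1
    have hr2 := mul_pos (div_pos hq hp1) hp2
    have hs1 := div_mul_cancel₀ (|mink l1 l2| + 1) hp1.ne'
    have hs2 := div_mul_cancel₀ (|mink l1 l2| + 1) hp2.ne'
    refine ⟨((|mink l1 l2| + 1) / mink l l1 + (|mink l1 l2| + 1) / mink l l2) • l
      + (-1 : ℝ) • l1 + (-1 : ℝ) • l2, ?_⟩
    simp only [Set.mem_inter_iff, Set.mem_ofPred_eq, mink_add_left, mink_smul_left, hl.2, h1.2,
      h2.2, mink_comm l1 l, mink_comm l2 l, mink_comm l2 l1, add_mul]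
    refine ⟨⟨?_, ?_⟩, ?_, ?_⟩ <;> linarith
  · have hopen (y : M4) : IsOpen {x | 0 < mink x y ∧ mink x l < 0} :=
      (isOpen_lt continuous_const (continuous_mink_left y)).inter
        (isOpen_lt (continuous_mink_left l) continuous_const)
    exact (hopen l1).inter (hopen l2)
end
end

section
/- Let a, b ∈ M4 with b − a in the open forward light cone V+, and let O = (a + V+) ∩ (b − V+) be the corresponding open double cone. Then the causal complement O' of O is connected. -/
noncomputable section

theorem continuous_mink_self : Continuous fun x : M4 => mink x x := by
  unfold mink
  fun_prop

theorem mink_smul_self (t : ℝ) (u : M4) : mink (t • u) (t • u) = t ^ 2 * mink u u := by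
  simp only [mink, Pi.smul_apply, smul_eq_mul]
  ring

theorem mink_sub_self_comm (x y : M4) : mink (x - y) (x - y) = mink (y - x) (y - x) := by
  simp only [mink, Pi.sub_apply]
  ring

theorem mink_nonneg_of_mem_cones {u w : M4} (hu : u ∈ openForwardCone)
    (hw : w ∈ closedForwardCone) : 0 ≤ mink u w := by
  obtain ⟨hu, hu0⟩ := hu
  obtain ⟨hw, hw0⟩ := hw
  unfold mink at *
  have hcs : (u 1 * w 1 + u 2 * w 2 + u 3 * w 3) ^ 2 ≤
      (u 1 ^ 2 + u 2 ^ 2 + u 3 ^ 2) * (w 1 ^ 2 + w 2 ^ 2 + w 3 ^ 2) := by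
    nlinarith [sq_nonneg (u 1 * w 2 - u 2 * w 1), sq_nonneg (u 1 * w 3 - u 3 * w 1),
      sq_nonneg (u 2 * w 3 - u 3 * w 2)]
  have hle : (u 1 ^ 2 + u 2 ^ 2 + u 3 ^ 2) * (w 1 ^ 2 + w 2 ^ 2 + w 3 ^ 2) ≤
      u 0 ^ 2 * w 0 ^ 2 := by
    apply mul_le_mul <;> first | positivity | linarith
  have := (abs_le_of_sq_le_sq' ((hcs.trans hle).trans_eq (mul_pow _ _ 2).symm)
    (by positivity)).2
  linarith

theorem add_mem_openForwardCone {u w : M4} (hu : u ∈ openForwardCone)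
    (hw : w ∈ closedForwardCone) : u + w ∈ openForwardCone := by
  have h := mink_nonneg_of_mem_cones hu hw
  obtain ⟨hu, hu0⟩ := hu
  obtain ⟨hw, hw0⟩ := hw
  refine ⟨?_, by simpa using add_pos_of_pos_of_nonneg hu0 hw0⟩
  unfold mink at *
  simp only [Pi.add_apply]
  nlinarith

theorem smul_mem_openForwardCone {u : M4} (hu : u ∈ openForwardCone) {t : ℝ} (ht : 0 < t) :
    t • u ∈ openForwardCone := by
  obtain ⟨hu, hu0⟩ := hu
  refine ⟨?_, by simpa using mul_pos ht hu0⟩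
  rw [mink_smul_self]
  positivity

/-- A point of the causal complement of `S` is spacelike to every point that is reached from
inside `S` along a short segment. -/
theorem mink_neg_of_mem_ccomp {S : Set M4} {x p e : M4} (hx : x ∈ ccomp S)
    (hp : ∀ t : ℝ, 0 < t → t < 1 → p + t • e ∈ S) : mink (x - p) (x - p) < 0 := by
  by_contra! h
  obtain ⟨σ, hσ, hσx⟩ : ∃ σ : ℝ, σ ^ 2 = 1 ∧ 0 ≤ σ * (x 0 - p 0) := by
    rcases le_total 0 (x 0 - p 0) with h0 | h0
    · exact ⟨1, by norm_num, by linarith⟩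
    · exact ⟨-1, by norm_num, by linarith⟩
  let z : ℝ → M4 := fun t => x + t • (e + Pi.single 0 σ)
  have hz : Continuous z := by fun_prop
  have hnhds : ∀ᶠ t in nhds (0 : ℝ), z t ∈ scomp S :=
    hz.continuousAt.eventually_mem (by simpa [z] using mem_interior_iff_mem_nhds.1 hx)
  have hpos : ∀ᶠ t in nhdsWithin (0 : ℝ) (Set.Ioi 0), z t ∈ scomp S ∧ t ∈ Set.Ioo (0 : ℝ) 1 :=
    (hnhds.filter_mono nhdsWithin_le_nhds).and (Ioo_mem_nhdsGT one_pos)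
  obtain ⟨t, hzt, ht0, ht1⟩ := hpos.exists
  have hneg := hzt _ (hp t ht0 ht1)
  have hexp : mink (z t - (p + t • e)) (z t - (p + t • e)) =
      mink (x - p) (x - p) + 2 * t * (σ * (x 0 - p 0)) + t ^ 2 * σ ^ 2 := by
    simp [mink, z]
    ring
  rw [hexp, hσ] at hneg
  have : 0 ≤ 2 * t * (σ * (x 0 - p 0)) := by positivity
  nlinarith

theorem ccomp_doubleCone_eq {a b : M4} (hab : b - a ∈ openForwardCone) :
    ccomp ({x | x - a ∈ openForwardCone} ∩ {x | b - x ∈ openForwardCone}) =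
      {x | mink (x - a) (x - a) < 0 ∧ mink (x - b) (x - b) < 0} := by
  apply Set.Subset.antisymm
  · intro x hx
    constructor
    · refine mink_neg_of_mem_ccomp (e := b - a) hx fun t ht0 ht1 => ⟨?_, ?_⟩
      · simpa using smul_mem_openForwardCone hab ht0
      · have := smul_mem_openForwardCone hab (sub_pos.2 ht1)
        rwa [show (1 - t) • (b - a) = b - (a + t • (b - a)) by module] at this
    · refine mink_neg_of_mem_ccomp (e := a - b) hx fun t ht0 ht1 => ⟨?_, ?_⟩
      · have := smul_mem_openForwardCone hab (sub_pos.2 ht1)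
        rwa [show (1 - t) • (b - a) = b + t • (a - b) - a by module] at this
      · have := smul_mem_openForwardCone hab ht0
        rwa [show t • (b - a) = b - (b + t • (a - b)) by module] at this
  · refine interior_maximal ?_ ?_
    · rintro x ⟨hxa, hxb⟩ s ⟨hsa, hsb⟩
      by_contra! h
      rcases le_total 0 ((x - s) 0) with h0 | h0
      · have := (add_mem_openForwardCone hsa ⟨h, h0⟩).1
        rw [show s - a + (x - s) = x - a by abel] at this
        exact lt_asymm hxa this
      · have hw : s - x ∈ closedForwardCone := by
          refine ⟨?_, by simpa using h0⟩
          rwa [mink_sub_self_comm]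
        have := (add_mem_openForwardCone hsb hw).1
        rw [show b - s + (s - x) = b - x by abel] at this
        rw [mink_sub_self_comm] at this
        exact lt_asymm hxb this
    · exact (isOpen_lt (continuous_mink_self.comp (continuous_id.sub continuous_const))
        continuous_const).inter (isOpen_lt
          (continuous_mink_self.comp (continuous_id.sub continuous_const)) continuous_const)

/-- The vector with spatial part `v` that is Minkowski-orthogonal to `d`. -/
def orthLift (d : M4) (v : Fin 3 → ℝ) : M4 :=
  ![(d 1 * v 0 + d 2 * v 1 + d 3 * v 2) / d 0, v 0, v 1, v 2]

theorem continuous_orthLift (d : M4) : Continuous (orthLift d) := by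
  refine continuous_pi fun i => ?_
  fin_cases i <;> simp [orthLift] <;> fun_prop

theorem orthLift_smul (d : M4) (t : ℝ) (v : Fin 3 → ℝ) :
    orthLift d (t • v) = t • orthLift d v := by
  ext i
  fin_cases i <;> simp [orthLift]
  ring

theorem mink_orthLift {d : M4} (hd : d 0 ≠ 0) (v : Fin 3 → ℝ) : mink (orthLift d v) d = 0 := by
  simp [mink, orthLift]
  field_simp
  ring

theorem orthLift_spatial {d p : M4} (hd : d 0 ≠ 0) (hp : mink p d = 0) :
    orthLift d ![p 1, p 2, p 3] = p := by
  ext i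
  fin_cases i <;> simp [orthLift]
  unfold mink at hp
  field_simp
  linarith

theorem mink_orthLift_self_neg {d : M4} (hd : d ∈ openForwardCone) {v : Fin 3 → ℝ}
    (hv : v ≠ 0) : mink (orthLift d v) (orthLift d v) < 0 := by
  obtain ⟨hd, hd0⟩ := hd
  have hpos : 0 < v 0 ^ 2 + v 1 ^ 2 + v 2 ^ 2 := by
    by_contra! h
    apply hv
    ext i
    fin_cases i <;> simp <;> nlinarith [sq_nonneg (v 0), sq_nonneg (v 1), sq_nonneg (v 2)]
  have hcs : (d 1 * v 0 + d 2 * v 1 + d 3 * v 2) ^ 2 ≤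
      (d 1 ^ 2 + d 2 ^ 2 + d 3 ^ 2) * (v 0 ^ 2 + v 1 ^ 2 + v 2 ^ 2) := by
    nlinarith [sq_nonneg (d 1 * v 1 - d 2 * v 0), sq_nonneg (d 1 * v 2 - d 3 * v 0),
      sq_nonneg (d 2 * v 2 - d 3 * v 1)]
  have hlt : ((d 1 * v 0 + d 2 * v 1 + d 3 * v 2) / d 0) ^ 2 < v 0 ^ 2 + v 1 ^ 2 + v 2 ^ 2 := by
    rw [div_pow, div_lt_iff₀ (by positivity)]
    refine hcs.trans_lt ?_
    rw [mul_comm]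
    apply mul_lt_mul_of_pos_left _ hpos
    unfold mink at hd
    linarith
  simp [mink, orthLift]
  linarith

/-- For `p` orthogonal to `d`, the vector `α d + p` is spacelike to both `d` and `-d` exactly when
`p` is longer than `(1 + |α|) d`. -/
theorem spacelike_pair_iff {d p : M4} (hD : 0 ≤ mink d d) (hp : mink p d = 0) (α : ℝ) :
    (mink (α • d + p + d) (α • d + p + d) < 0 ∧ mink (α • d + p - d) (α • d + p - d) < 0) ↔
      √(mink d d) * (1 + |α|) < √(-mink p p) := by
  have h1 : mink (α • d + p + d) (α • d + p + d) = (1 + α) ^ 2 * mink d d + mink p p := by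
    have : mink (α • d + p + d) (α • d + p + d) =
        (1 + α) ^ 2 * mink d d + mink p p + 2 * (1 + α) * mink p d := by
      simp [mink]
      ring
    rw [this, hp]
    ring
  have h2 : mink (α • d + p - d) (α • d + p - d) = (1 - α) ^ 2 * mink d d + mink p p := by
    have : mink (α • d + p - d) (α • d + p - d) =
        (1 - α) ^ 2 * mink d d + mink p p - 2 * (1 - α) * mink p d := by
      simp [mink]
      ring
    rw [this, hp]
    ring
  rw [h1, h2, Real.lt_sqrt (by positivity), mul_pow, Real.sq_sqrt hD]
  rcases abs_cases α with ⟨h, hα⟩ | ⟨h, hα⟩ <;> rw [h]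
  · refine ⟨fun hh => by linarith [hh.1], fun hh => ⟨by linarith, ?_⟩⟩
    nlinarith [mul_nonneg hα hD]
  · refine ⟨fun hh => by linarith [hh.2], fun hh => ⟨?_, by linarith⟩⟩
    nlinarith [mul_nonneg (neg_nonneg.2 hα.le) hD]

theorem sqrt_neg_mink_smul {t : ℝ} (ht : 0 ≤ t) (u : M4) :
    √(-mink (t • u) (t • u)) = t * √(-mink u u) := by
  rw [mink_smul_self, ← mul_neg, Real.sqrt_mul (by positivity), Real.sqrt_sq ht]

theorem isConnected_spacelike_pair {d : M4} (hd : d ∈ openForwardCone) :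
    IsConnected {y : M4 | mink (y + d) (y + d) < 0 ∧ mink (y - d) (y - d) < 0} := by
  have hD : 0 < mink d d := hd.1
  have hd0 : d 0 ≠ 0 := hd.2.ne'
  let k : ℝ → ℝ := fun α => √(mink d d) * (1 + |α|)
  have hk : ∀ α, 0 < k α := fun α => by positivity
  let q : (Fin 3 → ℝ) → ℝ := fun v => √(-mink (orthLift d v) (orthLift d v))
  have hq : ∀ v, v ≠ 0 → 0 < q v := fun v hv =>
    Real.sqrt_pos.2 (neg_pos.2 (mink_orthLift_self_neg hd hv))
  have hqc : Continuous q :=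
    Real.continuous_sqrt.comp (continuous_mink_self.comp (continuous_orthLift d)).neg
  have hkc : Continuous k := by fun_prop
  let F : ℝ × (Fin 3 → ℝ) → M4 := fun x =>
    x.1 • d + (1 + k x.1 / q x.2) • orthLift d x.2
  have hdom : IsConnected ((Set.univ : Set ℝ) ×ˢ ({0}ᶜ : Set (Fin 3 → ℝ))) := by
    refine isConnected_univ.prod (isConnected_compl_singleton_of_one_lt_rank ?_ 0)
    simp
  have hF : ContinuousOn F (Set.univ ×ˢ {0}ᶜ) := by
    have hquot : ContinuousOn (fun x : ℝ × (Fin 3 → ℝ) => k x.1 / q x.2) (Set.univ ×ˢ {0}ᶜ) :=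
      (hkc.comp continuous_fst).continuousOn.div (hqc.comp continuous_snd).continuousOn
        fun x hx => (hq x.2 hx.2).ne'
    exact (continuous_fst.smul continuous_const).continuousOn.add
      ((continuousOn_const.add hquot).smul
        ((continuous_orthLift d).comp continuous_snd).continuousOn)
  convert hdom.image F hF using 1
  ext y
  constructor
  · intro hy
    let α := mink y d / mink d d
    let p := y - α • d
    have hp : mink p d = 0 := by
      have : mink p d = mink y d - α * mink d d := by
        simp [mink, p]
        ring
      rw [this, div_mul_cancel₀ _ hD.ne', sub_self]
    have hyp : y = α • d + p := by simp [p]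
    rw [hyp] at hy ⊢
    have hlt : k α < √(-mink p p) := (spacelike_pair_iff hD.le hp α).1 hy
    set r := √(-mink p p) with hr
    have hr0 : 0 < r := (hk α).trans hlt
    have ht : 0 < 1 - k α / r := sub_pos.2 ((div_lt_one hr0).2 hlt)
    have hlift := orthLift_spatial hd0 hp
    let v := (1 - k α / r) • ![p 1, p 2, p 3]
    have hv : orthLift d v = (1 - k α / r) • p := by rw [orthLift_smul, hlift]
    have hqv : q v = r - k α := by
      change √(-mink (orthLift d v) (orthLift d v)) = _
      rw [hv, sqrt_neg_mink_smul ht.le, ← hr]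
      field_simp
    refine ⟨(α, v), ⟨Set.mem_univ _, ?_⟩, ?_⟩
    · rintro hv0
      rw [show v = 0 from hv0] at hqv
      have : q 0 = 0 := by simp [q, mink, orthLift]
      linarith
    · change α • d + (1 + k α / q v) • orthLift d v = _
      have hne : r - k α ≠ 0 := (sub_pos.2 hlt).ne'
      rw [hv, hqv, smul_smul, show (1 + k α / (r - k α)) * (1 - k α / r) = 1 by
        field_simp
        ring, one_smul]
  · rintro ⟨⟨α, v⟩, ⟨-, hv⟩, rfl⟩
    have hqv := hq v hv
    have hkα := hk α
    have hp : mink ((1 + k α / q v) • orthLift d v) d = 0 := by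
      have : mink ((1 + k α / q v) • orthLift d v) d =
          (1 + k α / q v) * mink (orthLift d v) d := by
        simp only [mink, Pi.smul_apply, smul_eq_mul]
        ring
      rw [this, mink_orthLift hd0, mul_zero]
    refine (spacelike_pair_iff hD.le hp α).2 ?_
    rw [sqrt_neg_mink_smul (by positivity)]
    change k α < (1 + k α / q v) * q v
    rw [add_mul, div_mul_cancel₀ _ hqv.ne']
    linarith

theorem ccomp_doubleCone_isConnected (a b : M4)
    (hab : b - a ∈ openForwardCone) :
    IsConnected (ccomp ({x | x - a ∈ openForwardCone} ∩ {x | b - x ∈ openForwardCone})) := by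
  rw [ccomp_doubleCone_eq hab]
  have hd : (1 / 2 : ℝ) • (b - a) ∈ openForwardCone := smul_mem_openForwardCone hab (by norm_num)
  convert (isConnected_spacelike_pair hd).image (fun y => y + (1 / 2 : ℝ) • (a + b))
    (by fun_prop) using 1
  ext x
  rw [Set.mem_image_iff_of_inverse (g := fun x => x - (1 / 2 : ℝ) • (a + b))
    (fun y => by simp) (fun y => by simp)]
  simp only [Set.mem_ofPred_eq]
  rw [show x - (1 / 2 : ℝ) • (a + b) + (1 / 2 : ℝ) • (b - a) = x - a by module,
    show x - (1 / 2 : ℝ) • (a + b) - (1 / 2 : ℝ) • (b - a) = x - b by module]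
end
end
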